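/- Let R be an integral domain whose integral closure R' (in its quotient field) satisfies (R : R') ≠ 0. If R is a big ideal domain, then R is a quasi-Prüfer domain, that is, R' is a Prüfer domain. -/

import Mathlib

/-- An ideal `I` of a commutative ring `R` is a *big ideal* if whenever `J ⊊ I`,
`J ^ n ⊊ I ^ n` for every positive integer `n`. -/
def Ideal.IsBig {R : Type*} [CommRing R] (I : Ideal R) : Prop :=
  ∀ J : Ideal R, J < I → ∀ n : ℕ, 1 ≤ n → J ^ n < I ^ n

/-- A commutative ring is a *big ideal ring* if every ideal is a big ideal. -/
def IsBigIdealRing (R : Type*) [CommRing R] : Prop :=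
  ∀ I : Ideal R, I.IsBig

/-- An integral domain is a *Prüfer domain* if every nonzero finitely generated ideal
is invertible (as a fractional ideal). -/
def IsPruferDomain (R : Type*) [CommRing R] [IsDomain R] : Prop :=
  ∀ I : Ideal R, I.FG → I ≠ ⊥ →
    IsUnit (I : FractionalIdeal (nonZeroDivisors R) (FractionRing R))


theorem bigSq_of_conductor (R : Type*) [CommRing R] [IsDomain R] (D : Type*) [CommRing D]
    [IsDomain D] [Algebra R D] (r : R) (f : D →ₗ[R] R) (hf : Function.Injective f)
    (hmul : ∀ s t, f s * f t = r * f (s * t))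
    (hR : IsBigIdealRing R) (I J : Ideal D) (hJI : J ≤ I) (h : I * I ≤ J * J) : I ≤ J := by
  let φ : Ideal D → Ideal R := fun I => (I.restrictScalars R).map f
  have mono : ∀ {A B : Ideal D}, A ≤ B → φ A ≤ φ B := fun h => Submodule.map_mono h
  have key1 : ∀ A : Ideal D, φ A * φ A ≤ Ideal.span {r} * φ (A * A) := by
    intro A
    rw [Ideal.mul_le]
    rintro _ ⟨s, hs, rfl⟩ _ ⟨t, ht, rfl⟩
    rw [hmul]
    exact Ideal.mul_mem_mul (Ideal.mem_span_singleton_self r)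
      ⟨s * t, Ideal.mul_mem_mul hs ht, rfl⟩
  have key2 : ∀ A : Ideal D, Ideal.span {r} * φ (A * A) ≤ φ A * φ A := by
    intro A
    rw [Ideal.span_singleton_mul_le_iff]
    rintro _ ⟨z, hz, rfl⟩
    have hz' : z ∈ A * A := hz
    induction hz' using Submodule.mul_induction_on' with
    | mem_mul_mem s hs t ht =>
      rw [← hmul]
      exact Ideal.mul_mem_mul ⟨s, hs, rfl⟩ ⟨t, ht, rfl⟩
    | add x hx y hy h1 h2 =>
      rw [map_add, mul_add]
      exact Ideal.add_mem _ (h1 hx) (h2 hy)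
  have hle : φ I * φ I ≤ φ J * φ J :=
    (key1 I).trans ((Ideal.mul_mono_right (mono h)).trans (key2 J))
  have heq : φ J = φ I := by
    by_contra hne
    have := hR (φ I) (φ J) (lt_of_le_of_ne (mono hJI) hne) 2 (by norm_num)
    rw [pow_two, pow_two] at this
    exact absurd hle (not_le_of_gt this)
  intro x hx
  have : f x ∈ φ J := heq ▸ ⟨x, hx, rfl⟩
  obtain ⟨y, hy, hxy⟩ := this
  exact hf hxy ▸ hy

theorem big_relation (D : Type*) [CommRing D]
    (h : ∀ I J : Ideal D, J ≤ I → I * I ≤ J * J → I ≤ J) (a b : D) :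
    ∃ c4 c3 c1 c0 : D, a ^ 2 * b ^ 2 = c4 * a ^ 4 + c3 * (a ^ 3 * b) + c1 * (a * b ^ 3)
      + c0 * b ^ 4 := by
  let J : Ideal D := Ideal.span {a ^ 4, a ^ 3 * b, a * b ^ 3, b ^ 4}
  have m4 : a ^ 4 ∈ J := Ideal.subset_span (by simp)
  have m3 : a ^ 3 * b ∈ J := Ideal.subset_span (by simp)
  have m1 : a * b ^ 3 ∈ J := Ideal.subset_span (by simp)
  have m0 : b ^ 4 ∈ J := Ideal.subset_span (by simp)
  have hm : ∀ x ∈ J, a ^ 2 * b ^ 2 * x ∈ J * J := by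
    intro x hx
    induction hx using Submodule.span_induction with
    | mem x hx =>
      simp only [Set.mem_insert_iff, Set.mem_singleton_iff] at hx
      rcases hx with rfl | rfl | rfl | rfl
      · convert Ideal.mul_mem_mul m3 m3 using 1; ring
      · convert Ideal.mul_mem_mul m4 m1 using 1; ring
      · convert Ideal.mul_mem_mul m3 m0 using 1; ring
      · convert Ideal.mul_mem_mul m1 m1 using 1; ring
    | zero => simp
    | add x y _ _ hx hy => rw [mul_add]; exact Ideal.add_mem _ hx hy
    | smul c x _ hx =>
      rw [smul_eq_mul, mul_left_comm]; exact Ideal.mul_mem_left _ _ hx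
  have := h (J ⊔ Ideal.span {a ^ 2 * b ^ 2}) J le_sup_left (by
    rw [Ideal.sup_mul, Ideal.mul_sup, Ideal.mul_sup]
    have h1 : Ideal.span {a ^ 2 * b ^ 2} * J ≤ J * J :=
      Ideal.span_singleton_mul_le_iff.2 hm
    refine sup_le (sup_le le_rfl ?_) (sup_le h1 ?_)
    · rw [mul_comm]; exact h1
    · rw [Ideal.span_singleton_mul_span_singleton, Ideal.span_singleton_le_iff_mem]
      convert Ideal.mul_mem_mul m4 m0 using 1; ring)
  have hmem : a ^ 2 * b ^ 2 ∈ J :=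
    this (Ideal.mem_sup_right (Ideal.mem_span_singleton_self _))
  simp only [J, Ideal.mem_span_insert, Ideal.mem_span_singleton'] at hmem
  obtain ⟨c4, _, ⟨c3, _, ⟨c1, _, ⟨c0, rfl⟩, rfl⟩, rfl⟩, hh⟩ := hmem
  exact ⟨c4, c3, c1, c0, by rw [hh]; ring⟩

/-- invertibility in terms of integral ideals -/
def PrufInv {D : Type*} [CommRing D] (I : Ideal D) : Prop :=
  ∃ (J : Ideal D) (c : D), c ≠ 0 ∧ I * J = Ideal.span {c}

theorem PrufInv.left {D : Type*} [CommRing D] {I J : Ideal D} (h : PrufInv (I * J)) :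
    PrufInv I := by
  obtain ⟨L, c, hc, h⟩ := h
  exact ⟨J * L, c, hc, by rw [← mul_assoc, h]⟩

theorem PrufInv.mul {D : Type*} [CommRing D] [IsDomain D] {I J : Ideal D} (h : PrufInv I)
    (h' : PrufInv J) : PrufInv (I * J) := by
  obtain ⟨L, c, hc, h⟩ := h
  obtain ⟨L', c', hc', h'⟩ := h'
  exact ⟨L * L', c * c', mul_ne_zero hc hc', by
    rw [mul_mul_mul_comm, h, h', Ideal.span_singleton_mul_span_singleton]⟩

theorem exists_of_monic {D K : Type*} [CommRing D] [IsDomain D] [Field K] [Algebra D K]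
    [IsFractionRing D K] [IsIntegrallyClosed D] (c p q s t : D) (x : K)
    (h : algebraMap D K c * x ^ 4 + algebraMap D K p * x ^ 3 + algebraMap D K q * x ^ 2 +
      algebraMap D K s * x + algebraMap D K t = 0) : 
    ∃ d : D, algebraMap D K d = algebraMap D K c * x := by
  apply IsIntegrallyClosed.isIntegral_iff.1
  let P : Polynomial D := Polynomial.X ^ 4 + (Polynomial.C p * Polynomial.X ^ 3 +
    Polynomial.C (q * c) * Polynomial.X ^ 2 + Polynomial.C (s * c ^ 2) * Polynomial.X
    + Polynomial.C (t * c ^ 3))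
  refine ⟨P, Polynomial.monic_X_pow_add (by
    refine lt_of_le_of_lt (b := (3 : WithBot ℕ)) ?_ (by norm_num)
    compute_degree!), ?_⟩
  simp only [P, Polynomial.eval₂_add, Polynomial.eval₂_mul, Polynomial.eval₂_pow,
    Polynomial.eval₂_X, Polynomial.eval₂_C, map_mul, map_pow]
  linear_combination (algebraMap D K c) ^ 3 * h

theorem prufInv_pair (D : Type*) [CommRing D] [IsDomain D] [IsIntegrallyClosed D]
    (h : ∀ I J : Ideal D, J ≤ I → I * I ≤ J * J → I ≤ J) (a b : D) (hb : b ≠ 0) :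
    PrufInv (Ideal.span {a, b}) := by
  obtain ⟨c4, c3, c1, c0, hc⟩ := big_relation D h a b
  let K := FractionRing D
  let m := algebraMap D K
  have hinj : Function.Injective m := IsFractionRing.injective D K
  have hb' : m b ≠ 0 := by
    intro h0; exact hb (hinj (by rw [h0, map_zero]))
  obtain ⟨x, hx⟩ : ∃ x : K, m a = x * m b := ⟨m a / m b, (div_mul_cancel₀ _ hb').symm⟩
  have hK : m c4 * x ^ 4 + m c3 * x ^ 3 + m (-1) * x ^ 2 + m c1 * x + m c0 = 0 := by
    have := congrArg m hc
    simp only [map_mul, map_add, map_pow, hx] at this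
    apply mul_right_cancel₀ (pow_ne_zero 4 hb')
    simp only [map_neg, map_one]
    linear_combination -this
  obtain ⟨d1, h1⟩ := exists_of_monic c4 c3 (-1) c1 c0 x hK
  change m d1 = m c4 * x at h1
  -- the degree three relation, multiplied by `x`
  by_cases hx0 : x = 0
  · have : a = 0 := hinj (by rw [hx, hx0]; simp)
    subst this
    refine ⟨⊤, b, hb, ?_⟩
    rw [Ideal.mul_top, Ideal.span_insert_zero]
  have hK3 : m 0 * x ^ 4 + m (d1 + c3) * x ^ 3 + m (-1) * x ^ 2 + m c1 * x + m c0 = 0 := by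
    simp only [map_add, map_zero] at hK ⊢
    rw [h1]; linear_combination hK
  have hK3' : m (d1 + c3) * x ^ 4 + m (-1) * x ^ 3 + m c1 * x ^ 2 + m c0 * x + m 0 = 0 := by
    simp only [map_zero] at hK3 ⊢
    linear_combination x * hK3
  obtain ⟨d2, h2⟩ := exists_of_monic _ _ _ _ _ x hK3'
  change m d2 = m (d1 + c3) * x at h2
  have hK2 : m (d2 - 1) * x ^ 4 + m c1 * x ^ 3 + m c0 * x ^ 2 + m 0 * x + m 0 = 0 := by
    simp only [map_sub, map_zero, map_one, map_neg] at hK3 ⊢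
    rw [h2]; linear_combination x ^ 2 * hK3
  obtain ⟨d3, h3⟩ := exists_of_monic _ _ _ _ _ x hK2
  change m d3 = m (d2 - 1) * x at h3
  have e1 : a * (d1 + c3) = b * d2 := hinj (by
    rw [map_mul, map_mul, h2, hx]; ring)
  have e2 : a * (d2 - 1) = b * d3 := hinj (by
    rw [map_mul, map_mul, h3, hx]; ring)
  refine ⟨Ideal.span {d1 + c3, d2 - 1}, b, hb, ?_⟩
  rw [Ideal.span_pair_mul_span_pair, e1, e2]
  apply le_antisymm
  · rw [Ideal.span_le]
    rintro y hy
    simp only [Set.mem_insert_iff, Set.mem_singleton_iff] at hy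
    rw [SetLike.mem_coe, Ideal.mem_span_singleton]
    rcases hy with rfl | rfl | rfl | rfl <;> exact Dvd.intro _ rfl
  · rw [Ideal.span_singleton_le_iff_mem]
    have : b = b * d2 - b * (d2 - 1) := by ring
    have hm : b * d2 - b * (d2 - 1) ∈
        Ideal.span {b * d2, b * d3, b * (d1 + c3), b * (d2 - 1)} :=
      Ideal.sub_mem _ (Ideal.subset_span (by simp)) (Ideal.subset_span (by simp))
    rwa [← this] at hm

theorem prufInv_fg (D : Type*) [CommRing D] [IsDomain D]
    (h : ∀ a b : D, b ≠ 0 → PrufInv (Ideal.span {a, b})) (n : ℕ) :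
    ∀ s : Finset D, s.card = n → Ideal.span (s : Set D) ≠ ⊥ → PrufInv (Ideal.span (s : Set D)) := by
  classical
  have hsing : ∀ b : D, b ≠ 0 → PrufInv (Ideal.span {b}) := by
    intro b hb
    exact ⟨⊤, b, hb, Ideal.mul_top _⟩
  induction n with
  | zero =>
    intro s hs hne
    rw [Finset.card_eq_zero] at hs
    subst hs; simp at hne
  | succ n ih =>
    intro s hs hne
    obtain ⟨c, t, hct, rfl, ht⟩ := Finset.card_eq_succ.1 hs
    by_cases hc : c = 0
    · subst hc
      rw [Finset.coe_insert, Ideal.span_insert_zero] at hne ⊢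
      exact ih t ht hne
    rcases t.eq_empty_or_nonempty with rfl | ⟨b, hbt⟩
    · simpa using hsing c hc
    obtain ⟨u, hbu, rfl⟩ : ∃ u, b ∉ u ∧ insert b u = t :=
      ⟨t.erase b, Finset.notMem_erase _ _, Finset.insert_erase hbt⟩
    by_cases hb : b = 0
    · subst hb
      rw [Finset.card_insert_of_notMem hbu] at ht
      have hcu : c ∉ u := fun hh => hct (Finset.mem_insert_of_mem hh)
      have := ih (insert c u) (by rw [Finset.card_insert_of_notMem hcu, ht])
      rw [Finset.insert_comm, Finset.coe_insert, Ideal.span_insert_zero] at hne ⊢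
      exact this hne
    have hcu : c ∉ u := fun hh => hct (Finset.mem_insert_of_mem hh)
    rw [Finset.card_insert_of_notMem hbu] at ht
    have i1 := ih (insert b u) (by rw [Finset.card_insert_of_notMem hbu, ht]) (by
      intro h0
      rw [Ideal.span_eq_bot] at h0
      exact hb (h0 b (by simp)))
    have i2 := ih (insert c u) (by rw [Finset.card_insert_of_notMem hcu, ht]) (by
      intro h0
      rw [Ideal.span_eq_bot] at h0
      exact hc (h0 c (by simp)))
    have i3 := h c b hb
    simp only [Finset.coe_insert, Ideal.span_insert] at i1 i2 i3 ⊢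
    have i4 := (i1.mul i2).mul i3
    generalize Ideal.span {b} = B at *
    generalize Ideal.span {c} = C at *
    generalize Ideal.span (u : Set D) = A at *
    have key : (B ⊔ A) * (C ⊔ A) * (C ⊔ B) = (C ⊔ (B ⊔ A)) * (A * B ⊔ B * C ⊔ C * A) := by
      simp only [← Submodule.add_eq_sup]
      have hid : ∀ X : Ideal D, X + X = X := fun X => by simp
      have e3 : A * B * C + A * B * C = A * B * C + A * B * C + A * B * C := by
        rw [hid, hid]
      calc _ = A * B * C + A * B * C + (B * C * C + B * B * C + A * B * B + A * A * B
                + A * C * C + A * A * C) := by ring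
        _ = A * B * C + A * B * C + A * B * C + (B * C * C + B * B * C + A * B * B + A * A * B
                + A * C * C + A * A * C) := by rw [← e3]
        _ = _ := by ring
    rw [key] at i4
    exact i4.left

theorem isPrufer_of_bigSq (D : Type*) [CommRing D] [IsDomain D] [IsIntegrallyClosed D]
    (hbig : ∀ I J : Ideal D, J ≤ I → I * I ≤ J * J → I ≤ J) : IsPruferDomain D := by
  intro I hI hne
  obtain ⟨s, rfl⟩ := hI
  obtain ⟨J, c, hc, hJ⟩ := prufInv_fg D (prufInv_pair D hbig) _ s rfl hne
  have hu : IsUnit ((Ideal.span {c} : Ideal D) :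
      FractionalIdeal (nonZeroDivisors D) (FractionRing D)) := by
    rw [FractionalIdeal.coeIdeal_span_singleton]
    have hc' : algebraMap D (FractionRing D) c ≠ 0 := fun h0 =>
      hc (IsFractionRing.injective D (FractionRing D) (by rw [h0, map_zero]))
    refine IsUnit.of_mul_eq_one (FractionalIdeal.spanSingleton _ (algebraMap D (FractionRing D) c)⁻¹) ?_
    rw [FractionalIdeal.spanSingleton_mul_spanSingleton, mul_inv_cancel₀ hc',
      FractionalIdeal.spanSingleton_one]
  rw [← hJ, FractionalIdeal.coeIdeal_mul] at hu
  exact isUnit_of_mul_isUnit_left hu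

/-- **Corollary 2.9.** Let `R` be an integral domain whose integral closure `R'`
(in its quotient field) satisfies `(R : R') ≠ 0`.  If `R` is a big ideal domain,
then `R` is quasi-Prüfer, i.e. `R'` is a Prüfer domain. -/
theorem isPruferDomain_integralClosure_of_isBigIdealRing (R : Type*) [CommRing R] [IsDomain R]
    (hcond : ∃ r : R, r ≠ 0 ∧ ∀ t ∈ integralClosure R (FractionRing R),
      algebraMap R (FractionRing R) r * t ∈ (algebraMap R (FractionRing R)).range)
    (hR : IsBigIdealRing R) :
    IsPruferDomain (integralClosure R (FractionRing R)) := by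
  obtain ⟨r, hr, hcond⟩ := hcond
  have hinj : Function.Injective (algebraMap R (FractionRing R)) :=
    IsFractionRing.injective R (FractionRing R)
  have hr' : algebraMap R (FractionRing R) r ≠ 0 := fun h0 =>
    hr (hinj (by rw [h0, map_zero]))
  choose g hg using fun t : integralClosure R (FractionRing R) => hcond t.1 t.2
  let f : integralClosure R (FractionRing R) →ₗ[R] R :=
    { toFun := g
      map_add' := fun x y => hinj (by
        rw [map_add, hg, hg, hg, ← mul_add]; rfl)
      map_smul' := fun c x => hinj (by
        rw [RingHom.id_apply, smul_eq_mul, map_mul, hg, hg, Subalgebra.coe_smul,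
          Algebra.smul_def]; ring) }
  have hf : Function.Injective f := by
    intro x y hxy
    have := congrArg (algebraMap R (FractionRing R)) (show g x = g y from hxy)
    rw [hg, hg] at this
    exact Subtype.ext (mul_left_cancel₀ hr' this)
  have hmul : ∀ s t, f s * f t = r * f (s * t) := by
    intro s t
    apply hinj
    change algebraMap _ _ (g s * g t) = algebraMap _ _ (r * g (s * t))
    rw [map_mul, map_mul, hg, hg, hg, MulMemClass.coe_mul]; ring
  have : IsFractionRing (integralClosure R (FractionRing R)) (FractionRing R) :=
    integralClosure.isFractionRing_of_finite_extension (FractionRing R) (FractionRing R)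
  have : IsIntegrallyClosed (integralClosure R (FractionRing R)) :=
    integralClosure.isIntegrallyClosedOfFiniteExtension (FractionRing R)
  have hbig := bigSq_of_conductor R (integralClosure R (FractionRing R)) r f hf hmul hR
  exact isPrufer_of_bigSq _ hbig
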